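/- Call a list l of positive integers admissible for n = 4 if l has odd length and the sum k of its entries satisfies k ≤ 5 and k is odd. Consider the equivalence relation on admissible lists generated by cyclic permutation (l is equivalent to any rotation of l) and by reversal (l is equivalent to its reverse). Then there are exactly 7 equivalence classes of admissible lists for n = 4, represented by (1), (3), (1,1,1), (5), (3,1,1), (2,2,1), and (1,1,1,1,1). -/

import Mathlib

/-- A list of positive integers is admissible for `n = 4` if it has odd length and its
sum `k` satisfies `k ≤ 5` and `k` is odd. -/
def AdmissibleFour (l : List ℕ) : Prop :=
  (∀ x ∈ l, 0 < x) ∧ Odd l.length ∧ l.sum ≤ 5 ∧ Odd l.sum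

/-- The elementary relation on lists generated by cyclic rotation and reversal. -/
def CycRevRel (l₁ l₂ : List ℕ) : Prop :=
  (∃ i, l₂ = l₁.rotate i) ∨ l₂ = l₁.reverse

/-- Cyclic rotation and reversal only permute the entries of a list. -/
theorem CycRevRel.perm {l₁ l₂ : List ℕ} (h : CycRevRel l₁ l₂) : l₁.Perm l₂ := by
  rcases h with ⟨i, rfl⟩ | rfl
  · exact (l₁.rotate_perm i).symm
  · exact l₁.reverse_perm.symm

theorem perm_of_eqvGen_cycRevRel {l₁ l₂ : List ℕ} (h : Relation.EqvGen CycRevRel l₁ l₂) :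
    l₁.Perm l₂ := by
  induction h with
  | rel _ _ h => exact h.perm
  | refl _ => exact .refl _
  | symm _ _ _ ih => exact ih.symm
  | trans _ _ _ _ _ ih₁ ih₂ => exact ih₁.trans ih₂

theorem eqvGen_cycRevRel_rotate (l : List ℕ) (i : ℕ) :
    Relation.EqvGen CycRevRel l (l.rotate i) :=
  .rel _ _ (.inl ⟨i, rfl⟩)

/-- Every admissible list is a rotation of one of the seven representatives. -/
theorem AdmissibleFour.exists_rotate_mem {l : List ℕ} (h : AdmissibleFour l) :
    ∃ i < 3, l.rotate i ∈
      [[1], [3], [1, 1, 1], [5], [3, 1, 1], [2, 2, 1], [1, 1, 1, 1, 1]] := by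
  obtain ⟨hpos, hlen, hle, hodd⟩ := h
  have hlen_le : l.length ≤ 5 := (List.length_le_sum_of_one_le l hpos).trans hle
  match l with
  | [] => simp at hlen
  | [a] =>
    simp only [List.sum_cons, List.sum_nil, add_zero] at hle hodd
    interval_cases a <;> revert hodd <;> decide
  | [_, _] => exact absurd hlen (by simp +decide)
  | [a, b, c] =>
    simp only [List.mem_cons, List.not_mem_nil, or_false, forall_eq_or_imp, forall_eq,
      List.sum_cons, List.sum_nil, add_zero] at hpos hle hodd
    obtain ⟨ha, hb, hc⟩ := hpos
    have ha' : a ≤ 3 := by omega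
    have hb' : b ≤ 3 := by omega
    have hc' : c ≤ 3 := by omega
    interval_cases a <;> interval_cases b <;> interval_cases c <;>
      revert hle hodd <;> decide
  | [_, _, _, _] => exact absurd hlen (by simp +decide)
  | [a, b, c, d, e] =>
    simp only [List.mem_cons, List.not_mem_nil, or_false, forall_eq_or_imp, forall_eq,
      List.sum_cons, List.sum_nil, add_zero] at hpos hle
    obtain ⟨rfl, rfl, rfl, rfl, rfl⟩ : a = 1 ∧ b = 1 ∧ c = 1 ∧ d = 1 ∧ e = 1 := by omega
    decide
  | _ :: _ :: _ :: _ :: _ :: _ :: _ =>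
    simp only [List.length_cons] at hlen_le
    omega

/-- There are exactly 7 equivalence classes of admissible lists for `n = 4` under the
equivalence generated by cyclic permutation and reversal, represented by
`(1)`, `(3)`, `(1,1,1)`, `(5)`, `(3,1,1)`, `(2,2,1)`, `(1,1,1,1,1)`. -/
theorem admissible_four_seven_classes :
    ∃ reps : List (List ℕ),
      reps = [[1], [3], [1, 1, 1], [5], [3, 1, 1], [2, 2, 1], [1, 1, 1, 1, 1]] ∧
      reps.length = 7 ∧
      (∀ l ∈ reps, AdmissibleFour l) ∧
      (∀ l, AdmissibleFour l → ∃ r ∈ reps, Relation.EqvGen CycRevRel l r) ∧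
      reps.Pairwise (fun r₁ r₂ => ¬ Relation.EqvGen CycRevRel r₁ r₂) := by
  refine ⟨_, rfl, rfl, ?_, fun l hl => ?_, ?_⟩
  · unfold AdmissibleFour
    decide
  · obtain ⟨i, -, hi⟩ := hl.exists_rotate_mem
    exact ⟨_, hi, eqvGen_cycRevRel_rotate l i⟩
  · refine List.Pairwise.imp (R := fun r₁ r₂ : List ℕ => ¬ r₁.Perm r₂)
      (fun hne h => hne (perm_of_eqvGen_cycRevRel h)) ?_
    decide
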